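/- ∫_0^∞ ϱ(u) du = e^γ, where ϱ is the Dickman function and γ is Euler's constant. -/

import Mathlib

open Real Set Filter Topology MeasureTheory

/-- The Dickman differential-delay equation for a continuous function on `ℝ`,
normalised to be `1` on `(-∞, 1]`. -/
structure IsDickman (ρ : ℝ → ℝ) : Prop where
  continuous : Continuous ρ
  eq_one : ∀ v ≤ 1, ρ v = 1
  hasDerivAt : ∀ v, 1 < v → HasDerivAt ρ (-ρ (v - 1) / v) v

/-- The Laplace transform of `ρ` on `(0, ∞)`. -/
noncomputable def dickmanLaplace (ρ : ℝ → ℝ) (s : ℝ) : ℝ :=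
  ∫ u in Ioi (0 : ℝ), ρ u * exp (-(s * u))

namespace IsDickman

variable {ρ : ℝ → ℝ}

lemma mul_eq_integral (h : IsDickman ρ) {v : ℝ} (hv : 1 ≤ v) :
    v * ρ v = ∫ u in (v - 1)..v, ρ u := by
  have hint (a b : ℝ) : IntervalIntegrable ρ volume a b := h.continuous.intervalIntegrable a b
  have hF (x : ℝ) : HasDerivAt (fun y => ∫ u in (0 : ℝ)..y, ρ u) (ρ x) x :=
    intervalIntegral.integral_hasDerivAt_right (hint 0 x)
      (h.continuous.stronglyMeasurableAtFilter _ _) h.continuous.continuousAt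
  have hD (x : ℝ) (hx : 1 < x) : HasDerivAt
      (fun y => y * ρ y - ((∫ u in (0 : ℝ)..y, ρ u) - ∫ u in (0 : ℝ)..(y - 1), ρ u)) 0 x := by
    have h2 := (hF (x - 1)).comp_sub_const x 1
    refine (((hasDerivAt_id x).mul (h.hasDerivAt x hx)).sub ((hF x).sub h2)).congr_deriv ?_
    have : x ≠ 0 := by positivity
    simp only [id]
    field_simp
    ring
  have hone : (∫ u in (0 : ℝ)..1, ρ u) = 1 := by
    rw [intervalIntegral.integral_congr (g := fun _ => (1 : ℝ))]
    · simp
    · intro u hu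
      rw [uIcc_of_le zero_le_one] at hu
      exact h.eq_one u hu.2
  have hsub (y : ℝ) : (∫ u in (0 : ℝ)..y, ρ u) - ∫ u in (0 : ℝ)..(y - 1), ρ u
      = ∫ u in (y - 1)..y, ρ u :=
    intervalIntegral.integral_interval_sub_left (hint _ _) (hint _ _)
  rw [← hsub, ← sub_eq_zero]
  rcases hv.eq_or_lt with rfl | hv
  · simp [h.eq_one, hone]
  have hcont : Continuous
      (fun y => y * ρ y - ((∫ u in (0 : ℝ)..y, ρ u) - ∫ u in (0 : ℝ)..(y - 1), ρ u)) := by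
    have hFc : Continuous (fun y => ∫ u in (0 : ℝ)..y, ρ u) :=
      continuous_iff_continuousAt.2 fun x => (hF x).continuousAt
    exact (continuous_id.mul h.continuous).sub
      (hFc.sub (hFc.comp (continuous_id.sub continuous_const)))
  obtain ⟨c, -, hc⟩ := exists_hasDerivAt_eq_slope _ (fun _ => (0 : ℝ)) hv hcont.continuousOn
    fun x hx => hD x hx.1
  rw [eq_comm, div_eq_zero_iff, or_iff_left (by linarith)] at hc
  simpa [h.eq_one, hone] using hc

lemma pos (h : IsDickman ρ) (v : ℝ) : 0 < ρ v := by
  by_contra! hv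
  let S : Set ℝ := {x | ρ x ≤ 0}
  have hS1 : ∀ x ∈ S, 1 ≤ x := by
    intro x hx
    by_contra! hx1
    have : ρ x ≤ 0 := hx
    rw [h.eq_one x hx1.le] at this
    linarith
  have hbdd : BddBelow S := ⟨1, hS1⟩
  have hmem : sInf S ∈ S :=
    (isClosed_le h.continuous continuous_const).csInf_mem ⟨v, hv⟩ hbdd
  have h1 := hS1 _ hmem
  have hpos : 0 < ∫ u in (sInf S - 1)..sInf S, ρ u := by
    refine intervalIntegral.intervalIntegral_pos_of_pos_on
      (h.continuous.intervalIntegrable _ _) (fun x hx => ?_) (by linarith)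
    by_contra! hx0
    exact absurd (csInf_le hbdd hx0) (not_le.2 hx.2)
  rw [← h.mul_eq_integral h1] at hpos
  have hle : ρ (sInf S) ≤ 0 := hmem
  nlinarith

lemma antitoneOn (h : IsDickman ρ) : AntitoneOn ρ (Ici 1) := by
  refine antitoneOn_of_deriv_nonpos (convex_Ici 1) h.continuous.continuousOn ?_ ?_ <;>
    rw [interior_Ici] <;> intro x (hx : 1 < x)
  · exact (h.hasDerivAt x hx).differentiableAt.differentiableWithinAt
  · rw [(h.hasDerivAt x hx).deriv]
    exact div_nonpos_of_nonpos_of_nonneg (neg_nonpos.2 (h.pos _).le) (by linarith)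

lemma le_one (h : IsDickman ρ) (v : ℝ) : ρ v ≤ 1 := by
  rcases le_total v 1 with hv | hv
  · exact (h.eq_one v hv).le
  · exact (h.antitoneOn self_mem_Ici hv hv).trans_eq (h.eq_one 1 le_rfl)

lemma mul_le (h : IsDickman ρ) {v : ℝ} (hv : 2 ≤ v) : v * ρ v ≤ ρ (v - 1) := by
  rw [h.mul_eq_integral (by linarith)]
  calc ∫ u in (v - 1)..v, ρ u ≤ ∫ _ in (v - 1)..v, ρ (v - 1) := by
        refine intervalIntegral.integral_mono_on (by linarith)
          (h.continuous.intervalIntegrable _ _) (by simp) fun x hx => ?_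
        have hx1 : 1 ≤ v - 1 := by linarith
        exact h.antitoneOn hx1 (hx1.trans hx.1) hx.1
    _ = ρ (v - 1) := by simp

lemma le_exp (h : IsDickman ρ) (v : ℝ) : ρ v ≤ exp (3 - v) := by
  have key (n : ℕ) : ∀ v : ℝ, v ≤ n + 3 → ρ v ≤ exp (3 - v) := by
    induction n with
    | zero =>
      intro v hv
      refine (h.le_one v).trans (one_le_exp ?_)
      simp at hv
      linarith
    | succ n ih =>
      intro v hv
      push_cast at hv
      rcases le_total v 3 with h3 | h3
      · exact (h.le_one v).trans (one_le_exp (by linarith))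
      have h1 := h.mul_le (v := v) (by linarith)
      have h2 := ih (v - 1) (by linarith)
      have h4 : exp (3 - (v - 1)) = exp 1 * exp (3 - v) := by
        rw [← exp_add]
        ring_nf
      have h5 : exp 1 ≤ 3 := exp_one_lt_three.le
      have h6 := exp_pos (3 - v)
      nlinarith [h.pos v]
  obtain ⟨n, hn⟩ := exists_nat_ge v
  exact key n v (by linarith)

lemma integrableOn_id_mul_exp : IntegrableOn (fun u : ℝ => u * exp (3 - u)) (Ioi 0) := by
  have := (Real.GammaIntegral_convergent (s := 2) two_pos).const_mul (exp 3)
  refine this.congr (ae_of_all _ fun u => ?_)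
  norm_num [exp_sub, exp_neg]
  ring

lemma integrableOn (h : IsDickman ρ) : IntegrableOn ρ (Ioi 0) := by
  have hexp : IntegrableOn (fun u : ℝ => exp (3 - u)) (Ioi 0) := by
    refine ((integrableOn_exp_mul_Ioi neg_one_lt_zero 0).const_mul (exp 3)).congr
      (ae_of_all _ fun u => ?_)
    simp [sub_eq_add_neg, exp_add]
  refine hexp.mono' h.continuous.aestronglyMeasurable (ae_of_all _ fun u => ?_)
  rw [norm_of_nonneg (h.pos u).le]
  exact h.le_exp u

lemma integrableOn_id_mul (h : IsDickman ρ) : IntegrableOn (fun u => u * ρ u) (Ioi 0) := by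
  refine integrableOn_id_mul_exp.mono'
    (continuous_id.mul h.continuous).aestronglyMeasurable ?_
  filter_upwards [ae_restrict_mem measurableSet_Ioi] with u (hu : 0 < u)
  rw [norm_of_nonneg (mul_pos hu (h.pos u)).le]
  exact mul_le_mul_of_nonneg_left (h.le_exp u) hu.le

lemma integrableOn_mul_exp (h : IsDickman ρ) {s : ℝ} (hs : 0 ≤ s) :
    IntegrableOn (fun u => ρ u * exp (-(s * u))) (Ioi 0) := by
  refine h.integrableOn.mono' (h.continuous.mul (by fun_prop)).aestronglyMeasurable ?_
  filter_upwards [ae_restrict_mem measurableSet_Ioi] with u (hu : 0 < u)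
  rw [norm_of_nonneg (mul_pos (h.pos u) (exp_pos _)).le]
  exact mul_le_of_le_one_right (h.pos u).le (exp_le_one_iff.2 (by nlinarith))

lemma norm_id_mul_exp_le (h : IsDickman ρ) {s u : ℝ} (hs : 0 ≤ s) (hu : 0 < u) :
    ‖u * ρ u * exp (-(s * u))‖ ≤ u * ρ u := by
  have hpos := mul_pos hu (h.pos u)
  rw [norm_of_nonneg (mul_pos hpos (exp_pos _)).le]
  exact mul_le_of_le_one_right hpos.le (exp_le_one_iff.2 (by nlinarith))

lemma integrableOn_id_mul_exp_mul (h : IsDickman ρ) {s : ℝ} (hs : 0 ≤ s) :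
    IntegrableOn (fun u => u * ρ u * exp (-(s * u))) (Ioi 0) := by
  refine h.integrableOn_id_mul.mono'
    ((continuous_id.mul h.continuous).mul (by fun_prop)).aestronglyMeasurable ?_
  filter_upwards [ae_restrict_mem measurableSet_Ioi] with u hu
  exact h.norm_id_mul_exp_le hs hu

lemma dickmanLaplace_pos (h : IsDickman ρ) {s : ℝ} (hs : 0 ≤ s) : 0 < dickmanLaplace ρ s := by
  refine (setIntegral_pos_iff_support_of_nonneg_ae (ae_of_all _ fun u => ?_)
    (h.integrableOn_mul_exp hs)).2 ?_
  · exact (mul_pos (h.pos u) (exp_pos _)).le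
  · have : Function.support (fun u => ρ u * exp (-(s * u))) = univ :=
      eq_univ_of_forall fun u => (mul_pos (h.pos u) (exp_pos _)).ne'
    simp [this]

lemma continuousWithinAt_dickmanLaplace (h : IsDickman ρ) :
    ContinuousWithinAt (dickmanLaplace ρ) (Ici 0) 0 := by
  refine continuousWithinAt_of_dominated (bound := ρ)
    (Eventually.of_forall fun s => (h.continuous.mul (by fun_prop)).aestronglyMeasurable)
    ?_ h.integrableOn (ae_of_all _ fun u => by fun_prop)
  filter_upwards [self_mem_nhdsWithin] with s (hs : 0 ≤ s)
  filter_upwards [ae_restrict_mem measurableSet_Ioi] with u (hu : 0 < u)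
  rw [norm_of_nonneg (mul_pos (h.pos u) (exp_pos _)).le]
  exact mul_le_of_le_one_right (h.pos u).le (exp_le_one_iff.2 (by nlinarith))

lemma hasDerivAt_dickmanLaplace_integral (h : IsDickman ρ) {s : ℝ} (hs : 0 < s) :
    HasDerivAt (dickmanLaplace ρ) (-∫ u in Ioi (0 : ℝ), u * ρ u * exp (-(s * u))) s := by
  rw [← integral_neg]
  refine (hasDerivAt_integral_of_dominated_loc_of_deriv_le
    (F := fun s u => ρ u * exp (-(s * u))) (F' := fun s u => -(u * ρ u * exp (-(s * u))))
    (bound := fun u => u * ρ u)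
    (Ioi_mem_nhds hs)
    (Eventually.of_forall fun s => (h.continuous.mul (by fun_prop)).aestronglyMeasurable)
    (h.integrableOn_mul_exp hs.le) (h.integrableOn_id_mul_exp_mul hs.le).neg.aestronglyMeasurable
    ?_ h.integrableOn_id_mul (ae_of_all _ fun u t _ => ?_)).2
  · filter_upwards [ae_restrict_mem measurableSet_Ioi] with u hu t (ht : 0 < t)
    rw [norm_neg]
    exact h.norm_id_mul_exp_le ht.le hu
  · refine ((((hasDerivAt_id t).mul_const u).neg.exp).const_mul (ρ u)).congr_deriv ?_
    simp
    ring

lemma integral_Ioi_one_comp_sub (s : ℝ) :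
    ∫ u in Ioi (1 : ℝ), ρ (u - 1) * exp (-(s * u)) = exp (-s) * dickmanLaplace ρ s := by
  have := (measurePreserving_sub_right volume (1 : ℝ)).setIntegral_preimage_emb
    (measurableEmbedding_subRight 1) (fun u => ρ u * exp (-(s * (u + 1)))) (Ioi 0)
  simp only [preimage_sub_const_Ioi, zero_add, sub_add_cancel] at this
  rw [this, dickmanLaplace, ← integral_const_mul]
  congr with u
  rw [mul_left_comm, ← exp_add]
  ring_nf

lemma tendsto_id_mul_exp (h : IsDickman ρ) {s : ℝ} (hs : 0 ≤ s) :
    Tendsto (fun u => u * ρ u * exp (-(s * u))) atTop (𝓝 0) := by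
  have hlim : Tendsto (fun u : ℝ => exp 3 * (u ^ 1 * exp (-u))) atTop (𝓝 0) := by
    simpa using (tendsto_pow_mul_exp_neg_atTop_nhds_zero 1).const_mul (exp 3)
  refine squeeze_zero_norm' ?_ hlim
  filter_upwards [eventually_gt_atTop 0] with u hu
  refine (h.norm_id_mul_exp_le hs hu).trans ?_
  have := mul_le_mul_of_nonneg_left (h.le_exp u) hu.le
  rw [sub_eq_add_neg, exp_add] at this
  linarith

lemma mul_integral_id_mul_exp (h : IsDickman ρ) {s : ℝ} (hs : 0 < s) :
    s * ∫ u in Ioi (0 : ℝ), u * ρ u * exp (-(s * u)) = (1 - exp (-s)) * dickmanLaplace ρ s := by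
  let g : ℝ → ℝ := fun u => ρ u * exp (-(s * u)) - s * (u * ρ u * exp (-(s * u)))
  have hg : IntegrableOn g (Ioi 0) :=
    (h.integrableOn_mul_exp hs.le).sub ((h.integrableOn_id_mul_exp_mul hs.le).const_mul s)
  have hsplit : (∫ u in (0 : ℝ)..1, g u) + ∫ u in Ioi (1 : ℝ), g u = ∫ u in Ioi (0 : ℝ), g u :=
    intervalIntegral.integral_interval_add_Ioi hg (hg.mono_set (Ioi_subset_Ioi zero_le_one))
  have htotal : ∫ u in Ioi (0 : ℝ), g u
      = dickmanLaplace ρ s - s * ∫ u in Ioi (0 : ℝ), u * ρ u * exp (-(s * u)) := by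
    rw [dickmanLaplace, ← integral_const_mul]
    exact integral_sub (h.integrableOn_mul_exp hs.le)
      ((h.integrableOn_id_mul_exp_mul hs.le).const_mul s)
  have hexp (u : ℝ) : HasDerivAt (fun u => exp (-(s * u))) (-s * exp (-(s * u))) u := by
    refine (((hasDerivAt_id u).const_mul s).neg.exp).congr_deriv ?_
    simp
    ring
  have hhead : ∫ u in (0 : ℝ)..1, g u = exp (-s) := by
    have hcongr : EqOn g (fun u => exp (-(s * u)) + u * (-s * exp (-(s * u)))) (uIcc 0 1) := by
      intro u hu
      rw [uIcc_of_le zero_le_one] at hu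
      simp only [g, h.eq_one u hu.2]
      ring
    rw [intervalIntegral.integral_congr hcongr,
      intervalIntegral.integral_eq_sub_of_hasDerivAt (f := fun u => u * exp (-(s * u)))]
    · simp
    · intro u _
      exact ((hasDerivAt_id u).mul (hexp u)).congr_deriv (by simp)
    · exact Continuous.intervalIntegrable (by fun_prop) _ _
  have hshift : IntegrableOn (fun u => ρ (u - 1) * exp (-(s * u))) (Ioi 1) := by
    refine .of_integral_ne_zero ?_
    rw [integral_Ioi_one_comp_sub]
    exact (mul_pos (exp_pos _) (h.dickmanLaplace_pos hs.le)).ne'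
  have htail : (∫ u in Ioi (1 : ℝ), g u) - exp (-s) * dickmanLaplace ρ s = 0 - exp (-s) := by
    rw [← integral_Ioi_one_comp_sub,
      ← integral_sub (hg.mono_set (Ioi_subset_Ioi zero_le_one)) hshift,
      integral_Ioi_of_hasDerivAt_of_tendsto (f := fun u => u * ρ u * exp (-(s * u)))
        _ _ _ (h.tendsto_id_mul_exp hs.le)]
    · simp [h.eq_one]
    · exact (Continuous.mul (continuous_id.mul h.continuous) (by fun_prop)).continuousWithinAt
    · intro u (hu : 1 < u)
      refine (((hasDerivAt_id u).mul (h.hasDerivAt u hu)).mul (hexp u)).congr_deriv ?_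
      have : u ≠ 0 := by positivity
      simp only [id, g, Pi.mul_apply]
      field_simp
      ring
    · exact (hg.mono_set (Ioi_subset_Ioi zero_le_one)).sub hshift
  linarith

lemma mul_dickmanLaplace_le_one (h : IsDickman ρ) {s : ℝ} (hs : 0 < s) :
    s * dickmanLaplace ρ s ≤ 1 := by
  have hs' : -s < 0 := neg_lt_zero.2 hs
  have := setIntegral_mono (h.integrableOn_mul_exp hs.le) (integrableOn_exp_mul_Ioi hs' 0)
    fun u => by
      simpa only [neg_mul] using mul_le_of_le_one_left (exp_pos (-(s * u))).le (h.le_one u)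
  rw [integral_exp_mul_Ioi hs'] at this
  simp only [mul_zero, exp_zero, neg_div_neg_eq] at this
  rw [mul_comm]
  exact (le_div_iff₀ hs).1 this

lemma le_mul_dickmanLaplace (h : IsDickman ρ) {s : ℝ} (hs : 0 < s) :
    1 - exp (-s) ≤ s * dickmanLaplace ρ s := by
  have hs' : -s < 0 := neg_lt_zero.2 hs
  have hsplit := intervalIntegral.integral_interval_add_Ioi (h.integrableOn_mul_exp hs.le)
    ((h.integrableOn_mul_exp hs.le).mono_set (Ioi_subset_Ioi zero_le_one))
  have htail : 0 ≤ ∫ u in Ioi (1 : ℝ), ρ u * exp (-(s * u)) :=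
    integral_nonneg fun u => (mul_pos (h.pos u) (exp_pos _)).le
  have hhead : s * ∫ u in (0 : ℝ)..1, ρ u * exp (-(s * u)) = 1 - exp (-s) := by
    rw [← intervalIntegral.integral_const_mul,
      intervalIntegral.integral_congr (g := fun u => s * exp (-(s * u))),
      intervalIntegral.integral_eq_sub_of_hasDerivAt (f := fun u => -exp (-(s * u)))]
    · simp
      ring
    · intro u _
      refine (((hasDerivAt_id u).const_mul s).neg.exp).neg.congr_deriv ?_
      simp
      ring
    · exact Continuous.intervalIntegrable (by fun_prop) _ _
    · intro u hu
      rw [uIcc_of_le zero_le_one] at hu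
      simp [h.eq_one u hu.2]
  rw [dickmanLaplace, ← hsplit, mul_add, hhead]
  exact le_add_of_nonneg_right (mul_nonneg hs.le htail)

lemma tendsto_mul_dickmanLaplace (h : IsDickman ρ) :
    Tendsto (fun s => s * dickmanLaplace ρ s) atTop (𝓝 1) := by
  have hlim : Tendsto (fun s : ℝ => 1 - exp (-s)) atTop (𝓝 1) := by
    simpa using (tendsto_exp_neg_atTop_nhds_zero).const_sub 1
  refine tendsto_of_tendsto_of_tendsto_of_le_of_le' hlim tendsto_const_nhds ?_ ?_ <;>
    filter_upwards [eventually_gt_atTop 0] with s hs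
  · exact h.le_mul_dickmanLaplace hs
  · exact h.mul_dickmanLaplace_le_one hs

lemma hasDerivAt_log_dickmanLaplace (h : IsDickman ρ) {s : ℝ} (hs : 0 < s) :
    HasDerivAt (fun s => log (dickmanLaplace ρ s)) (-(1 - exp (-s)) / s) s := by
  have hL := h.dickmanLaplace_pos hs.le
  refine ((h.hasDerivAt_dickmanLaplace_integral hs).log hL.ne').congr_deriv ?_
  rw [div_eq_div_iff hL.ne' hs.ne']
  linarith [h.mul_integral_id_mul_exp hs]

end IsDickman

lemma integral_log_mul_exp_neg :
    ∫ t in Ioi (0 : ℝ), log t * exp (-t) = -eulerMascheroniConstant := by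
  have h1 : HasDerivAt Complex.Gamma
      (∫ t : ℝ in Ioi 0, (t : ℂ) ^ ((1 : ℂ) - 1) * (Real.log t * Real.exp (-t))) 1 := by
    refine (Complex.hasDerivAt_GammaIntegral (s := 1) (by simp)).congr_of_eventuallyEq ?_
    filter_upwards [(Complex.continuous_re.isOpen_preimage _ isOpen_Ioi).mem_nhds
      (show (1 : ℂ) ∈ Complex.re ⁻¹' Ioi 0 by simp)] with z hz
    exact Complex.Gamma_eq_integral hz
  have h2 := h1.unique Complex.hasDerivAt_Gamma_one
  simp only [sub_self, Complex.cpow_zero, one_mul, ← Complex.ofReal_mul] at h2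
  rw [integral_complex_ofReal] at h2
  exact_mod_cast h2

lemma integrableOn_log_mul_exp_neg :
    IntegrableOn (fun t : ℝ => log t * exp (-t)) (Ioi 0) := by
  refine .of_integral_ne_zero ?_
  rw [integral_log_mul_exp_neg]
  linarith [one_half_lt_eulerMascheroniConstant]

lemma continuousWithinAt_one_sub_exp_neg_mul_log :
    ContinuousWithinAt (fun s : ℝ => (1 - exp (-s)) * log s) (Ici 0) 0 := by
  rw [← continuousWithinAt_Ioi_iff_Ici]
  have hlim : Tendsto (fun s : ℝ => |log s * s|) (𝓝[>] 0) (𝓝 0) := by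
    simpa using (tendsto_log_mul_rpow_nhdsGT_zero one_pos).abs
  have : Tendsto (fun s : ℝ => (1 - exp (-s)) * log s) (𝓝[>] 0) (𝓝 0) := by
    refine squeeze_zero_norm' ?_ hlim
    filter_upwards [self_mem_nhdsWithin] with s (hs : 0 < s)
    have h1 : 0 ≤ 1 - exp (-s) := by simpa using hs.le
    have h2 : 1 - exp (-s) ≤ s := by linarith [add_one_le_exp (-s)]
    rw [norm_mul, norm_of_nonneg h1, abs_mul, abs_of_pos hs, mul_comm, norm_eq_abs]
    exact mul_le_mul_of_nonneg_left h2 (abs_nonneg _)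
  simpa [ContinuousWithinAt] using this

theorem IsDickman.integral_eq {ρ : ℝ → ℝ} (h : IsDickman ρ) :
    ∫ u in Ioi (0 : ℝ), ρ u = exp eulerMascheroniConstant := by
  let K : ℝ → ℝ := fun s => log (dickmanLaplace ρ s) + (1 - exp (-s)) * log s
  have hcont : ContinuousWithinAt K (Ici 0) 0 :=
    (h.continuousWithinAt_dickmanLaplace.log (h.dickmanLaplace_pos le_rfl).ne').add
      continuousWithinAt_one_sub_exp_neg_mul_log
  have hderiv (s : ℝ) (hs : s ∈ Ioi (0 : ℝ)) : HasDerivAt K (log s * exp (-s)) s := by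
    have hs0 : s ≠ 0 := (mem_Ioi.1 hs).ne'
    refine ((h.hasDerivAt_log_dickmanLaplace hs).add
      (((hasDerivAt_neg s).exp.const_sub 1).mul (hasDerivAt_log hs0))).congr_deriv ?_
    field_simp
    ring
  have hlim : Tendsto K atTop (𝓝 0) := by
    have h1 : Tendsto (fun s => log (s * dickmanLaplace ρ s)) atTop (𝓝 0) := by
      simpa using h.tendsto_mul_dickmanLaplace.log one_ne_zero
    have h2 : Tendsto (fun s : ℝ => exp (-s) * log s) atTop (𝓝 0) := by
      refine squeeze_zero_norm' ?_ (tendsto_pow_mul_exp_neg_atTop_nhds_zero 1)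
      filter_upwards [eventually_ge_atTop 1] with s hs
      rw [norm_of_nonneg (mul_nonneg (exp_pos _).le (log_nonneg hs)), pow_one, mul_comm]
      exact mul_le_mul_of_nonneg_right (log_le_self (by linarith)) (exp_pos _).le
    have h3 := h1.sub h2
    rw [sub_zero] at h3
    refine h3.congr' ?_
    filter_upwards [eventually_gt_atTop 0] with s hs
    simp only [K]
    rw [log_mul hs.ne' (h.dickmanLaplace_pos hs.le).ne']
    ring
  have hint := integral_Ioi_of_hasDerivAt_of_tendsto hcont hderiv
    integrableOn_log_mul_exp_neg hlim
  rw [integral_log_mul_exp_neg] at hint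
  have hL : log (dickmanLaplace ρ 0) = eulerMascheroniConstant := by
    simp [K] at hint
    linarith
  rw [← hL, exp_log (h.dickmanLaplace_pos le_rfl)]
  simp [dickmanLaplace]

theorem dickman_integral_eq_exp_gamma
    (ϱ : ℝ → ℝ)
    (hcont : ContinuousOn ϱ (Set.Ici 0))
    (hinit : ∀ v : ℝ, 0 ≤ v → v ≤ 1 → ϱ v = 1)
    (hode : ∀ v : ℝ, 1 < v → ∃ d : ℝ, HasDerivAt ϱ d v ∧ v * d + ϱ (v - 1) = 0) :
    ∫ u in Set.Ioi (0 : ℝ), ϱ u = Real.exp Real.eulerMascheroniConstant := by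
  have h : IsDickman fun v => ϱ (max v 0) := by
    refine ⟨?_, fun v hv => hinit _ (le_max_right _ _) (max_le hv zero_le_one), fun v hv => ?_⟩
    · exact hcont.comp_continuous (by fun_prop) fun v => le_max_right v 0
    · obtain ⟨d, hd, hd'⟩ := hode v hv
      have hdv : -ϱ (max (v - 1) 0) / v = d := by
        rw [max_eq_left (by linarith), div_eq_iff (by positivity)]
        linarith
      rw [hdv]
      refine hd.congr_of_eventuallyEq ?_
      filter_upwards [Ioi_mem_nhds hv] with x (hx : 1 < x)
      rw [max_eq_left (by linarith)]
  rw [← h.integral_eq]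
  refine setIntegral_congr_fun measurableSet_Ioi fun u (hu : 0 < u) => ?_
  simp only [max_eq_left hu.le]
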